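/- arXiv:math/0611957 — 2 statements merged into one kernel-verified Lean document; each statement's English description precedes it below -/
import Mathlib

section
/- Let U be an n×n real matrix with UᵀU = n·I and coherence μ = max_{k,j} |U_{k,j}|, fix T ⊆ {1,…,n} and t₀ ∉ T, and let u^k = (U_{k,t})_{t∈T} and λ_k⁰ = U_{k,t₀}. Let δ₁,…,δ_n be i.i.d. Bernoulli random variables with P(δ_k = 1) = m/n, and set v⁰ = Σ_{k=1}^n δ_k λ_k⁰ u^k ∈ ℝ^{|T|}. Then E ‖v⁰‖² ≤ μ² · m · |T|, where ‖·‖ is the Euclidean norm. -/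
open Classical Finset Matrix Real

/-- Spectral (operator ℓ²) norm of a real matrix. -/
noncomputable def specNorm {ι κ : Type*} [Fintype ι] [Fintype κ] [DecidableEq κ]
    (A : Matrix ι κ ℝ) : ℝ :=
  ‖LinearMap.toContinuousLinearMap (Matrix.toEuclideanLin A)‖

/-- Coherence: the largest magnitude among the entries of `U`. -/
noncomputable def coh {n : ℕ} (U : Matrix (Fin n) (Fin n) ℝ) : ℝ :=
  ⨆ k, ⨆ j, |U k j|

/-- Uniform probability of the event `E` on the finite sample space `s`. -/
noncomputable def uprob {α : Type*} (s : Finset α) (E : α → Prop) : ℝ :=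
  ((s.filter E).card : ℝ) / s.card

/-- Weight of the outcome `ω` for i.i.d. Bernoulli(m/n) variables `δ_k = ω k`. -/
noncomputable def bweight (n m : ℕ) (ω : Fin n → Bool) : ℝ :=
  ∏ k, if ω k then (m : ℝ) / n else 1 - (m : ℝ) / n

/-- Expectation under the i.i.d. Bernoulli(m/n) model. -/
noncomputable def bexp (n m : ℕ) (f : (Fin n → Bool) → ℝ) : ℝ :=
  ∑ ω : Fin n → Bool, bweight n m ω * f ω

/-- Probability of an event under the i.i.d. Bernoulli(m/n) model. -/
noncomputable def bprob (n m : ℕ) (E : (Fin n → Bool) → Prop) : ℝ :=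
  ∑ ω : Fin n → Bool, if E ω then bweight n m ω else 0

/-- Euclidean norm of a finitely indexed real vector. -/
noncomputable def l2norm {ι : Type*} [Fintype ι] (v : ι → ℝ) : ℝ :=
  Real.sqrt (∑ i, v i ^ 2)

theorem bexp_prod_indicator (n m : ℕ) (S : Finset (Fin n)) :
    bexp n m (fun ω => ∏ k ∈ S, if ω k then (1 : ℝ) else 0) = ((m : ℝ) / n) ^ S.card := by
  let g : Fin n → Bool → ℝ := fun k b =>
    (if b then (m : ℝ) / n else 1 - (m : ℝ) / n) *
      (if k ∈ S then (if b then (1 : ℝ) else 0) else 1)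
  have hg : ∀ k, ∑ b, g k b = if k ∈ S then (m : ℝ) / n else 1 := by
    intro k
    by_cases hk : k ∈ S <;> simp [g, hk]
  calc bexp n m (fun ω => ∏ k ∈ S, if ω k then (1 : ℝ) else 0)
      = ∑ ω : Fin n → Bool, ∏ k, g k (ω k) := by
        refine Finset.sum_congr rfl fun ω _ => ?_
        simp only [g, Finset.prod_mul_distrib, bweight, Finset.prod_ite_mem, Finset.univ_inter]
    _ = ∏ k, ∑ b, g k b := (Fintype.prod_sum g).symm
    _ = ((m : ℝ) / n) ^ S.card := by
        simp only [hg, Finset.prod_ite_mem, Finset.univ_inter, Finset.prod_const]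

theorem bexp_sum {ι : Type*} (n m : ℕ) (s : Finset ι) (f : ι → (Fin n → Bool) → ℝ) :
    bexp n m (fun ω => ∑ i ∈ s, f i ω) = ∑ i ∈ s, bexp n m (f i) := by
  simp only [bexp, Finset.mul_sum]
  exact Finset.sum_comm

theorem bexp_const_mul (n m : ℕ) (c : ℝ) (f : (Fin n → Bool) → ℝ) :
    bexp n m (fun ω => c * f ω) = c * bexp n m f := by
  simp only [bexp, Finset.mul_sum, mul_left_comm]

theorem bexp_indicator_mul_indicator (n m : ℕ) (k l : Fin n) :
    bexp n m (fun ω => (if ω k then (1 : ℝ) else 0) * (if ω l then (1 : ℝ) else 0)) =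
      ((m : ℝ) / n) ^ 2 + if k = l then (m : ℝ) / n - ((m : ℝ) / n) ^ 2 else 0 := by
  by_cases h : k = l
  · subst h
    have := bexp_prod_indicator n m {k}
    simp only [Finset.prod_singleton, Finset.card_singleton, pow_one] at this
    simpa [← ite_and] using this
  · have := bexp_prod_indicator n m {k, l}
    rw [Finset.card_pair h] at this
    simpa only [Finset.prod_pair h, h, if_false, add_zero] using this

/-- Second moment of a linear combination of i.i.d. Bernoulli variables. -/
theorem bexp_sq_sum (n m : ℕ) (a : Fin n → ℝ) :
    bexp n m (fun ω => (∑ k, (if ω k then (1 : ℝ) else 0) * a k) ^ 2) =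
      ((m : ℝ) / n) ^ 2 * (∑ k, a k) ^ 2 +
        ((m : ℝ) / n - ((m : ℝ) / n) ^ 2) * ∑ k, a k ^ 2 := by
  have hexp : ∀ ω : Fin n → Bool, (∑ k, (if ω k then (1 : ℝ) else 0) * a k) ^ 2 =
      ∑ k, ∑ l, (a k * a l) *
        ((if ω k then (1 : ℝ) else 0) * (if ω l then (1 : ℝ) else 0)) := by
    intro ω
    rw [sq, Finset.sum_mul_sum]
    exact Finset.sum_congr rfl fun k _ => Finset.sum_congr rfl fun l _ => by ring
  simp only [hexp, bexp_sum, bexp_const_mul, bexp_indicator_mul_indicator]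
  simp only [mul_add, Finset.sum_add_distrib, mul_ite, mul_zero, Finset.sum_ite_eq,
    Finset.mem_univ, if_true]
  simp only [← Finset.sum_mul, ← Finset.sum_mul_sum, ← sq]
  ring

theorem abs_apply_le_coh {n : ℕ} (U : Matrix (Fin n) (Fin n) ℝ) (k j : Fin n) :
    |U k j| ≤ coh U :=
  (le_ciSup (f := fun j => |U k j|) (Set.finite_range _).bddAbove j).trans
    (le_ciSup (f := fun k => ⨆ j, |U k j|) (Set.finite_range _).bddAbove k)

/-- Lemma 3.3.  With coherence `μ`, `t₀ ∉ T`,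
`u^k = (U_{k,t})_{t∈T}`, `λ_k⁰ = U_{k,t₀}`, i.i.d. Bernoulli(m/n) variables
`δ_k`, and `v⁰ = Σ_k δ_k λ_k⁰ u^k`, one has `E‖v⁰‖² ≤ μ²·m·|T|`. -/
theorem statement8 (n m : ℕ) (U : Matrix (Fin n) (Fin n) ℝ)
    (hU : Uᵀ * U = (n : ℝ) • (1 : Matrix (Fin n) (Fin n) ℝ))
    (T : Finset (Fin n)) (t₀ : Fin n) (ht₀ : t₀ ∉ T) (hmn : m ≤ n) :
    bexp n m
        (fun ω =>
          ∑ t : ↥T,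
            (∑ k : Fin n, (if ω k then (1 : ℝ) else 0) * U k t₀ * U k t.1) ^ 2) ≤
      coh U ^ 2 * m * T.card := by
  have hcol : ∀ i j, ∑ k, U k i * U k j = if i = j then (n : ℝ) else 0 := by
    intro i j
    have := congrFun (congrFun hU i) j
    simpa [Matrix.mul_apply, Matrix.one_apply] using this
  have hn : (n : ℝ) ≠ 0 := Nat.cast_ne_zero.mpr t₀.pos.ne'
  have hcoord : ∀ t : ↥T, bexp n m (fun ω =>
      (∑ k, (if ω k then (1 : ℝ) else 0) * U k t₀ * U k t.1) ^ 2) ≤ coh U ^ 2 * m := by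
    intro t
    have hne : t₀ ≠ t.1 := fun h => ht₀ (h ▸ t.2)
    have hsq : ∑ k, (U k t₀ * U k t.1) ^ 2 ≤ coh U ^ 2 * n :=
      calc ∑ k, (U k t₀ * U k t.1) ^ 2
          ≤ ∑ k, coh U ^ 2 * (U k t.1 * U k t.1) := by
            refine Finset.sum_le_sum fun k _ => ?_
            rw [mul_pow, ← sq (U k t.1), ← sq_abs (U k t₀)]
            gcongr
            exact abs_apply_le_coh U k t₀
        _ = coh U ^ 2 * n := by rw [← Finset.mul_sum, hcol, if_pos rfl]
    simp only [mul_assoc]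
    rw [bexp_sq_sum, hcol, if_neg hne]
    calc ((m : ℝ) / n) ^ 2 * 0 ^ 2 +
          ((m : ℝ) / n - ((m : ℝ) / n) ^ 2) * ∑ k, (U k t₀ * U k t.1) ^ 2
        ≤ (m : ℝ) / n * ∑ k, (U k t₀ * U k t.1) ^ 2 := by
          have : 0 ≤ ((m : ℝ) / n) ^ 2 * ∑ k, (U k t₀ * U k t.1) ^ 2 := by positivity
          linarith
      _ ≤ (m : ℝ) / n * (coh U ^ 2 * n) := by gcongr
      _ = coh U ^ 2 * m := by field_simp
  rw [bexp_sum]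
  refine (Finset.sum_le_sum fun t _ => hcoord t).trans_eq ?_
  simp [mul_comm]
end

section
/- There exists an absolute positive constant γ such that the following holds. Let U be an n×n real matrix with UᵀU = n·I and coherence μ = max_{k,j} |U_{k,j}|, fix T ⊆ {1,…,n}, let δ₁,…,δ_n be i.i.d. Bernoulli random variables with P(δ_k = 1) = m/n, and let Ω = {k : δ_k = 1}. For t₀ ∉ T define v^{t₀} = Σ_{k=1}^n δ_k U_{k,t₀} u^k where u^k = (U_{k,t})_{t∈T}, and on the event that U_{ΩT}ᵀ U_{ΩT} is invertible set w^{t₀} = (U_{ΩT}ᵀ U_{ΩT})^{−1} v^{t₀}. Let σ̄² = μ² m · max(1, μ|T|/√m), and fix a > 0 obeying a ≤ (m/μ²)^{1/4} if μ|T|/√m > 1 and a ≤ (m/(μ²|T|))^{1/2} otherwise. Then P( λ_min(U_{ΩT}ᵀ U_{ΩT}) < m/2, or sup_{t₀ ∉ T} ‖w^{t₀}‖ ≥ 2μ√(|T|/m) + 2aσ̄/m ) ≤ n·e^{−γ a²} + P( λ_min(U_{ΩT}ᵀ U_{ΩT}) < m/2 ), where λ_min denotes the smallest eigenvalue and ‖·‖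 the Euclidean norm. -/
open Classical Finset Matrix Real

/-- Weight of `ω` under the product of Bernoulli(`p`) laws. -/
noncomputable def bernWeight {n : ℕ} (p : ℝ) (ω : Fin n → Bool) : ℝ :=
  ∏ k, if ω k then p else 1 - p

/-- Expectation under the product of Bernoulli(`p`) laws. -/
noncomputable def bernE {n : ℕ} (p : ℝ) (f : (Fin n → Bool) → ℝ) : ℝ :=
  ∑ ω, bernWeight p ω * f ω

/-- Entropy of a two-valued function under the Bernoulli(`p`) law. -/
noncomputable def bernEnt (p x y : ℝ) : ℝ :=
  p * (x * Real.log x) + (1 - p) * (y * Real.log y)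
    - (p * x + (1 - p) * y) * Real.log (p * x + (1 - p) * y)

lemma bernWeight_nonneg {n : ℕ} {p : ℝ} (h0 : 0 ≤ p) (h1 : p ≤ 1) (ω : Fin n → Bool) :
    0 ≤ bernWeight p ω :=
  Finset.prod_nonneg fun k _ => by split_ifs <;> linarith

lemma bernE_mono {n : ℕ} {p : ℝ} (h0 : 0 ≤ p) (h1 : p ≤ 1) {f g : (Fin n → Bool) → ℝ}
    (h : ∀ ω, f ω ≤ g ω) : bernE p f ≤ bernE p g :=
  Finset.sum_le_sum fun ω _ => mul_le_mul_of_nonneg_left (h ω) (bernWeight_nonneg h0 h1 ω)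

lemma bernE_add {n : ℕ} (p : ℝ) (f g : (Fin n → Bool) → ℝ) :
    bernE p (fun ω => f ω + g ω) = bernE p f + bernE p g := by
  simp only [bernE, mul_add, Finset.sum_add_distrib]

lemma bernE_const_mul {n : ℕ} (p c : ℝ) (f : (Fin n → Bool) → ℝ) :
    bernE p (fun ω => c * f ω) = c * bernE p f := by
  simp only [bernE, Finset.mul_sum]
  exact Finset.sum_congr rfl fun _ _ => by ring

lemma bernE_sum {n : ℕ} (p : ℝ) {κ : Type*} (s : Finset κ) (f : κ → (Fin n → Bool) → ℝ) :
    bernE p (fun ω => ∑ k ∈ s, f k ω) = ∑ k ∈ s, bernE p (f k) := by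
  simp only [bernE, Finset.mul_sum]
  exact Finset.sum_comm

lemma bernE_zero (p : ℝ) (f : (Fin 0 → Bool) → ℝ) : bernE p f = f Fin.elim0 := by
  simp only [bernE, bernWeight, Fintype.sum_unique, Finset.univ_eq_empty, Finset.prod_empty,
    one_mul]
  congr 1

lemma bernE_succ {n : ℕ} (p : ℝ) (f : (Fin (n + 1) → Bool) → ℝ) :
    bernE p f = p * bernE p (fun ω => f (Fin.cons true ω))
      + (1 - p) * bernE p (fun ω => f (Fin.cons false ω)) := by
  have h : bernE p f = ∑ x : Bool × (Fin n → Bool),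
      bernWeight p (Fin.cons x.1 x.2 : Fin (n + 1) → Bool) * f (Fin.cons x.1 x.2) :=
    (Fintype.sum_equiv (Fin.consEquiv fun _ => Bool) _ _ fun _ => rfl).symm
  rw [h, Fintype.sum_prod_type]
  simp only [bernE, bernWeight, Fin.prod_univ_succ, Fin.cons_zero, Fin.cons_succ,
    Fintype.sum_bool, Finset.mul_sum]
  simp [mul_assoc]

lemma bernE_const {n : ℕ} (p c : ℝ) : bernE p (fun _ : Fin n → Bool => c) = c := by
  induction n with
  | zero => exact bernE_zero p _
  | succ n ih => rw [bernE_succ, ih]; ring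

lemma bernE_pos {n : ℕ} {p : ℝ} (h0 : 0 ≤ p) (h1 : p ≤ 1) {f : (Fin n → Bool) → ℝ}
    (h : ∀ ω, 0 < f ω) : 0 < bernE p f := by
  obtain ⟨ω₀, hω₀⟩ := Finite.exists_min f
  calc 0 < f ω₀ := h ω₀
    _ = bernE p (fun _ : Fin n → Bool => f ω₀) := (bernE_const p _).symm
    _ ≤ bernE p f := bernE_mono h0 h1 hω₀

lemma bernE_linear_combination {n : ℕ} (p a b : ℝ) (f g : (Fin n → Bool) → ℝ) :
    bernE p (fun ω => a * f ω + b * g ω) = a * bernE p f + b * bernE p g := by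
  rw [bernE_add, bernE_const_mul, bernE_const_mul]

/-- Supporting hyperplanes of the two-point entropy. -/
lemma linear_le_bernEnt {p a b x y : ℝ} (h0 : 0 ≤ p) (h1 : p ≤ 1) (ha : 0 < a) (hb : 0 < b)
    (hx : 0 < x) (hy : 0 < y) :
    p * (Real.log a - Real.log (p * a + (1 - p) * b)) * x
      + (1 - p) * (Real.log b - Real.log (p * a + (1 - p) * b)) * y ≤ bernEnt p x y := by
  have pos : ∀ u v : ℝ, 0 < u → 0 < v → 0 < p * u + (1 - p) * v := by
    intro u v hu hv
    rcases h0.eq_or_lt with rfl | hp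
    · simpa using hv
    · have := mul_pos hp hu
      have := mul_nonneg (sub_nonneg.2 h1) hv.le
      linarith
  have hc := pos a b ha hb
  have hz := pos x y hx hy
  set c := p * a + (1 - p) * b with hcdef
  set z := p * x + (1 - p) * y with hzdef
  have key : ∀ u w : ℝ, 0 < u → 0 < w →
      w * (Real.log u - Real.log c) ≤ w * (Real.log w - Real.log z) - w + z * u / c := by
    intro u w hu hw
    have h := Real.log_le_sub_one_of_pos (x := z * u / (w * c)) (by positivity)
    rw [Real.log_div (by positivity) (by positivity), Real.log_mul hz.ne' hu.ne',
      Real.log_mul hw.ne' hc.ne'] at h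
    have h2 := mul_le_mul_of_nonneg_left h hw.le
    have h3 : w * (z * u / (w * c) - 1) = z * u / c - w := by field_simp
    rw [h3] at h2
    linarith
  have e1 := mul_le_mul_of_nonneg_left (key a x ha hx) h0
  have e2 := mul_le_mul_of_nonneg_left (key b y hb hy) (sub_nonneg.2 h1)
  have e3 : p * (z * a / c) + (1 - p) * (z * b / c) = z := by
    have : p * (z * a / c) + (1 - p) * (z * b / c) = z * c / c := by rw [hcdef]; ring
    rw [this, mul_div_cancel_right₀ _ hc.ne']
  have e4 : bernEnt p x y = p * (x * (Real.log x - Real.log z))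
      + (1 - p) * (y * (Real.log y - Real.log z)) := by
    rw [bernEnt, ← hzdef]
    nth_rewrite 1 [hzdef]
    ring
  rw [e4]
  linarith

/-- Joint convexity of the two-point entropy, in the form of Jensen's inequality. -/
lemma bernEnt_bernE_le {n : ℕ} {p : ℝ} (h0 : 0 ≤ p) (h1 : p ≤ 1) {f g : (Fin n → Bool) → ℝ}
    (hf : ∀ ω, 0 < f ω) (hg : ∀ ω, 0 < g ω) :
    bernEnt p (bernE p f) (bernE p g) ≤ bernE p (fun ω => bernEnt p (f ω) (g ω)) := by
  have h := bernE_mono h0 h1 fun ω =>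
    linear_le_bernEnt h0 h1 (bernE_pos h0 h1 hf) (bernE_pos h0 h1 hg) (hf ω) (hg ω)
  rw [bernE_linear_combination] at h
  refine le_trans (le_of_eq ?_) h
  rw [bernEnt]
  ring

/-- Tensorization of entropy for products of Bernoulli laws. -/
theorem entropy_tensorization {n : ℕ} {p : ℝ} (h0 : 0 ≤ p) (h1 : p ≤ 1)
    {f : (Fin n → Bool) → ℝ} (hf : ∀ ω, 0 < f ω) :
    bernE p (fun ω => f ω * Real.log (f ω)) - bernE p f * Real.log (bernE p f) ≤
      ∑ k, bernE p (fun ω => bernEnt p (f (Function.update ω k true))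
        (f (Function.update ω k false))) := by
  induction n with
  | zero => simp [bernE_zero]
  | succ n ih =>
    have hT := ih (f := fun ω => f (Fin.cons true ω)) fun _ => hf _
    have hF := ih (f := fun ω => f (Fin.cons false ω)) fun _ => hf _
    have hJ := bernEnt_bernE_le h0 h1 (f := fun ω : Fin n → Bool => f (Fin.cons true ω))
      (g := fun ω => f (Fin.cons false ω)) (fun _ => hf _) (fun _ => hf _)
    have hT' := mul_le_mul_of_nonneg_left hT h0
    have hF' := mul_le_mul_of_nonneg_left hF (sub_nonneg.2 h1)
    rw [Fin.sum_univ_succ]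
    simp only [bernE_succ p (n := n), Fin.update_cons_zero, ← Fin.cons_update,
      Finset.sum_add_distrib, ← Finset.mul_sum]
    rw [bernEnt] at hJ
    linarith

lemma bernEnt_exp_le {p : ℝ} (h0 : 0 ≤ p) (h1 : p ≤ 1) (x y : ℝ) :
    bernEnt p (Real.exp x) (Real.exp y) ≤
      p * (1 - p) * ((x - y) * (Real.exp x - Real.exp y)) := by
  have hconv : Real.exp (p * x + (1 - p) * y) ≤ p * Real.exp x + (1 - p) * Real.exp y :=
    convexOn_exp.2 (Set.mem_univ x) (Set.mem_univ y) h0 (sub_nonneg.2 h1) (by ring)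
  have hz := (Real.exp_pos _).trans_le hconv
  have hlog := (Real.le_log_iff_exp_le hz).2 hconv
  have := mul_le_mul_of_nonneg_left hlog hz.le
  rw [bernEnt, Real.log_exp, Real.log_exp]
  linarith

lemma sub_mul_exp_sub_exp_le {x y : ℝ} (h : |x - y| ≤ 1) :
    (x - y) * (Real.exp x - Real.exp y) ≤ Real.exp 1 * (x - y) ^ 2 * Real.exp x := by
  have aux : ∀ u v : ℝ, Real.exp u - Real.exp v ≤ (u - v) * Real.exp u := by
    intro u v
    have h := Real.add_one_le_exp (v - u)
    have h2 : Real.exp v = Real.exp u * Real.exp (v - u) := by rw [← Real.exp_add]; ring_nf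
    nlinarith [Real.exp_pos u]
  have h1 : (1 : ℝ) ≤ Real.exp 1 := Real.one_le_exp zero_le_one
  rcases le_total y x with hxy | hxy
  · have h2 := mul_le_mul_of_nonneg_left (aux x y) (sub_nonneg.2 hxy)
    have h3 : 0 ≤ (x - y) ^ 2 * Real.exp x := by positivity
    nlinarith
  · have h2 := mul_le_mul_of_nonneg_left (aux y x) (sub_nonneg.2 hxy)
    have h3 : Real.exp y ≤ Real.exp 1 * Real.exp x := by
      rw [← Real.exp_add]
      exact Real.exp_le_exp.2 (by linarith [neg_le_abs (x - y)])
    nlinarith [mul_le_mul_of_nonneg_left h3 (sq_nonneg (x - y))]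

/-- Modified logarithmic Sobolev inequality for functions with bounded discrete gradient. -/
theorem entropy_exp_le {n : ℕ} {p D : ℝ} (h0 : 0 ≤ p) (h1 : p ≤ 1) {g : (Fin n → Bool) → ℝ}
    (hinc : ∀ ω k, |g (Function.update ω k true) - g (Function.update ω k false)| ≤ 1)
    (hD : ∀ ω, ∑ k, p * (g (Function.update ω k true) - g (Function.update ω k false)) ^ 2 ≤ D) :
    bernE p (fun ω => Real.exp (g ω) * g ω)
        - bernE p (fun ω => Real.exp (g ω)) * Real.log (bernE p fun ω => Real.exp (g ω)) ≤
      Real.exp 1 * D * bernE p (fun ω => Real.exp (g ω)) := by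
  have h := entropy_tensorization h0 h1 (f := fun ω => Real.exp (g ω)) fun _ => Real.exp_pos _
  simp only [Real.log_exp] at h
  refine h.trans ?_
  rw [← bernE_sum, ← bernE_const_mul]
  refine bernE_mono h0 h1 fun ω => ?_
  have hterm : ∀ k, bernEnt p (Real.exp (g (Function.update ω k true)))
      (Real.exp (g (Function.update ω k false))) ≤ Real.exp 1 * Real.exp (g ω) *
        (p * (g (Function.update ω k true) - g (Function.update ω k false)) ^ 2) := by
    intro k
    have hb : (g (Function.update ω k true) - g (Function.update ω k false)) *
        (Real.exp (g (Function.update ω k true)) - Real.exp (g (Function.update ω k false))) ≤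
        Real.exp 1 * (g (Function.update ω k true) - g (Function.update ω k false)) ^ 2 *
          Real.exp (g ω) := by
      rcases hω : ω k with _ | _
      · have e : Function.update ω k false = ω := by rw [← hω, Function.update_eq_self]
        have := sub_mul_exp_sub_exp_le ((abs_sub_comm _ _).trans_le (hinc ω k))
        rw [e] at this ⊢
        linarith
      · have e : Function.update ω k true = ω := by rw [← hω, Function.update_eq_self]
        have := sub_mul_exp_sub_exp_le (hinc ω k)
        rw [e] at this ⊢
        linarith
    have hpq : p * (1 - p) ≤ p := by nlinarith
    have hnn : 0 ≤ Real.exp 1 * (g (Function.update ω k true) -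
        g (Function.update ω k false)) ^ 2 * Real.exp (g ω) := by positivity
    have := bernEnt_exp_le h0 h1 (g (Function.update ω k true)) (g (Function.update ω k false))
    have e1 := mul_le_mul_of_nonneg_left hb (mul_nonneg h0 (sub_nonneg.2 h1))
    have e2 := mul_le_mul_of_nonneg_right hpq hnn
    linarith
  calc _ ≤ ∑ k, Real.exp 1 * Real.exp (g ω) *
        (p * (g (Function.update ω k true) - g (Function.update ω k false)) ^ 2) :=
        Finset.sum_le_sum fun k _ => hterm k
    _ = Real.exp 1 * Real.exp (g ω) * ∑ k,
        p * (g (Function.update ω k true) - g (Function.update ω k false)) ^ 2 := by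
        rw [Finset.mul_sum]
    _ ≤ Real.exp 1 * Real.exp (g ω) * D :=
        mul_le_mul_of_nonneg_left (hD ω) (by positivity)
    _ = _ := by ring

lemma hasDerivAt_bernE_exp {n : ℕ} (p : ℝ) (f : (Fin n → Bool) → ℝ) (l : ℝ) :
    HasDerivAt (fun l => bernE p fun ω => Real.exp (l * f ω))
      (bernE p fun ω => Real.exp (l * f ω) * f ω) l := by
  simp only [bernE]
  refine HasDerivAt.fun_sum fun ω _ => ?_
  refine HasDerivAt.const_mul _ ?_
  simpa using ((hasDerivAt_id l).mul_const (f ω)).exp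

/-- Herbst's argument. -/
theorem log_bernE_exp_le {n : ℕ} {p B D : ℝ} (h0 : 0 ≤ p) (h1 : p ≤ 1)
    {f : (Fin n → Bool) → ℝ}
    (hinc : ∀ ω k, |f (Function.update ω k true) - f (Function.update ω k false)| ≤ B)
    (hD : ∀ ω, ∑ k, p * (f (Function.update ω k true) - f (Function.update ω k false)) ^ 2 ≤ D)
    {l : ℝ} (hl : 0 < l) (hlB : l * B ≤ 1) :
    Real.log (bernE p fun ω => Real.exp (l * f ω)) ≤ l * bernE p f + Real.exp 1 * D * l ^ 2 := by
  set H : ℝ → ℝ := fun l => bernE p fun ω => Real.exp (l * f ω) with hH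
  have hHpos : ∀ x, 0 < H x := fun x => bernE_pos h0 h1 fun _ => Real.exp_pos _
  have hHd : ∀ x, HasDerivAt H (bernE p fun ω => Real.exp (x * f ω) * f ω) x :=
    hasDerivAt_bernE_exp p f
  set ψ : ℝ → ℝ := fun x => Real.log (H x) / x - Real.exp 1 * D * x with hψ
  have hψd : ∀ x, 0 < x → HasDerivAt ψ
      (((bernE p fun ω => Real.exp (x * f ω) * f ω) / H x * x - Real.log (H x) * 1) / x ^ 2
        - Real.exp 1 * D * 1) x := fun x hx =>
    (((hHd x).log (hHpos x).ne').div (hasDerivAt_id x) hx.ne').sub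
      ((hasDerivAt_id x).const_mul _)
  have hanti : AntitoneOn ψ (Set.Ioc 0 l) := by
    refine antitoneOn_of_deriv_nonpos (convex_Ioc 0 l)
      (fun x hx => (hψd x hx.1).continuousAt.continuousWithinAt)
      (fun x hx => (hψd x (interior_subset hx).1).differentiableAt.differentiableWithinAt) ?_
    intro x hx
    have hx' := interior_subset hx
    have hx0 : 0 < x := hx'.1
    rw [(hψd x hx0).deriv]
    have hE := entropy_exp_le h0 h1 (g := fun ω => x * f ω) (D := x ^ 2 * D) (by
      intro ω k
      rw [← mul_sub, abs_mul, abs_of_pos hx0]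
      have hB : 0 ≤ B := (abs_nonneg _).trans (hinc ω k)
      calc _ ≤ x * B := mul_le_mul_of_nonneg_left (hinc ω k) hx0.le
        _ ≤ l * B := mul_le_mul_of_nonneg_right hx'.2 hB
        _ ≤ 1 := hlB) (by
      intro ω
      refine le_trans (le_of_eq ?_) (mul_le_mul_of_nonneg_left (hD ω) (sq_nonneg x))
      rw [Finset.mul_sum]
      exact Finset.sum_congr rfl fun _ _ => by ring)
    have e : (bernE p fun ω => Real.exp (x * f ω) * (x * f ω)) =
        x * bernE p fun ω => Real.exp (x * f ω) * f ω := by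
      rw [← bernE_const_mul]
      congr 1
      funext ω
      ring
    rw [e] at hE
    change x * _ - H x * Real.log (H x) ≤ Real.exp 1 * (x ^ 2 * D) * H x at hE
    have hHx := hHpos x
    rw [sub_nonpos, div_le_iff₀ (by positivity), mul_one, mul_one, div_mul_eq_mul_div,
      sub_le_iff_le_add, div_le_iff₀ hHx]
    linarith
  have hlim : Filter.Tendsto ψ (nhdsWithin 0 (Set.Ioi 0)) (nhds (bernE p f)) := by
    have hH0 : H 0 = 1 := by simp [hH, bernE_const]
    have hd : HasDerivAt (fun x => Real.log (H x)) (bernE p f) 0 := by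
      have := (hHd 0).log (hHpos 0).ne'
      rw [hH0] at this
      simpa using this
    have hs := (hasDerivAt_iff_tendsto_slope.1 hd).mono_left
      (nhdsWithin_mono 0 (fun x (hx : 0 < x) => hx.ne'))
    have hc : Filter.Tendsto (fun x : ℝ => Real.exp 1 * D * x) (nhdsWithin 0 (Set.Ioi 0))
        (nhds 0) := by
      have : Continuous fun x : ℝ => Real.exp 1 * D * x := by fun_prop
      simpa using (this.tendsto 0).mono_left nhdsWithin_le_nhds
    have := hs.sub hc
    rw [sub_zero] at this
    refine this.congr fun x => ?_
    simp [hψ, slope_def_field, hH0]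
  have hle : ψ l ≤ bernE p f := by
    refine ge_of_tendsto hlim ?_
    filter_upwards [Ioc_mem_nhdsGT hl] with x hx
    exact hanti hx ⟨hl, le_rfl⟩ hx.2
  have := mul_le_mul_of_nonneg_left hle hl.le
  have e : l * ψ l = Real.log (H l) - Real.exp 1 * D * l ^ 2 := by
    simp only [hψ]
    field_simp
  rw [e] at this
  linarith

lemma abs_sqrt_norm_add_sub_le {E : Type*} [SeminormedAddCommGroup E] (c : ℝ) (x y : E) :
    |√(‖x + y‖ ^ 2 + c ^ 2) - √(‖x‖ ^ 2 + c ^ 2)| ≤ ‖y‖ := by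
  set r := √(‖x‖ ^ 2 + c ^ 2) with hr
  set s := √(‖x + y‖ ^ 2 + c ^ 2) with hs
  have hr2 : r ^ 2 = ‖x‖ ^ 2 + c ^ 2 := Real.sq_sqrt (by positivity)
  have hs2 : s ^ 2 = ‖x + y‖ ^ 2 + c ^ 2 := Real.sq_sqrt (by positivity)
  have hrx : ‖x‖ ≤ r := Real.le_sqrt_of_sq_le (by nlinarith [sq_nonneg c])
  have hsx : ‖x + y‖ ≤ s := Real.le_sqrt_of_sq_le (by nlinarith [sq_nonneg c])
  have h1 : ‖x + y‖ ≤ ‖x‖ + ‖y‖ := norm_add_le x y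
  have h2 : ‖x‖ ≤ ‖x + y‖ + ‖y‖ := by simpa using norm_sub_le (x + y) y
  have hx := norm_nonneg x
  have hxy := norm_nonneg (x + y)
  have hy := norm_nonneg y
  rw [abs_le]
  constructor
  · refine (by by_contra! h; nlinarith : -‖y‖ ≤ s - r)
  · refine (by by_contra! h; nlinarith : s - r ≤ ‖y‖)

section Hilbert

variable {E : Type*} [NormedAddCommGroup E] [InnerProductSpace ℝ E]

/-- The random sum `∑ δ_k Y_k`. -/
noncomputable def bernSum {n : ℕ} (Y : Fin n → E) (ω : Fin n → Bool) : E :=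
  ∑ k, (if ω k then (1 : ℝ) else 0) • Y k

lemma bernSum_cons {n : ℕ} (Y : Fin (n + 1) → E) (b : Bool) (ω : Fin n → Bool) :
    bernSum Y (Fin.cons b ω) =
      (if b then (1 : ℝ) else 0) • Y 0 + bernSum (fun k => Y k.succ) ω := by
  simp [bernSum, Fin.sum_univ_succ]

lemma bernSum_update {n : ℕ} (Y : Fin n → E) (ω : Fin n → Bool) (k : Fin n) :
    bernSum Y (Function.update ω k true) = bernSum Y (Function.update ω k false) + Y k := by
  simp only [bernSum]
  rw [← Finset.add_sum_erase _ _ (Finset.mem_univ k),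
    ← Finset.add_sum_erase Finset.univ
      (fun j => (if Function.update ω k false j then (1 : ℝ) else 0) • Y j) (Finset.mem_univ k)]
  have : ∀ b, ∑ x ∈ Finset.univ.erase k,
      (if Function.update ω k b x then (1 : ℝ) else 0) • Y x =
      ∑ x ∈ Finset.univ.erase k, (if ω x then (1 : ℝ) else 0) • Y x := by
    intro b
    refine Finset.sum_congr rfl fun x hx => ?_
    rw [Function.update_of_ne (Finset.ne_of_mem_erase hx)]
  rw [this, this]
  simp [add_comm]

lemma bernE_inner_bernSum {n : ℕ} (p : ℝ) (Y : Fin n → E) (x : E) :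
    bernE p (fun ω => inner ℝ x (bernSum Y ω)) = p * inner ℝ x (∑ k, Y k) := by
  induction n with
  | zero => simp [bernE_zero, bernSum]
  | succ n ih =>
    rw [bernE_succ]
    simp only [bernSum_cons, inner_add_right, bernE_add, ih, bernE_const, Fin.sum_univ_succ]
    simp
    ring

lemma bernE_norm_sq_bernSum {n : ℕ} (p : ℝ) (Y : Fin n → E) :
    bernE p (fun ω => ‖bernSum Y ω‖ ^ 2) =
      p ^ 2 * ‖∑ k, Y k‖ ^ 2 + p * (1 - p) * ∑ k, ‖Y k‖ ^ 2 := by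
  induction n with
  | zero => simp [bernE_zero, bernSum]
  | succ n ih =>
    rw [bernE_succ]
    simp only [bernSum_cons, norm_add_sq_real, bernE_add, ih, bernE_const, bernE_const_mul,
      bernE_inner_bernSum, Fin.sum_univ_succ]
    simp
    ring

lemma sq_sqrt_norm_add_sub_le {c : ℝ} (hc : 0 < c) (x y : E) :
    (√(‖x + y‖ ^ 2 + c ^ 2) - √(‖x‖ ^ 2 + c ^ 2)) ^ 2 ≤
      8 * (inner ℝ x y) ^ 2 / (‖x‖ ^ 2 + c ^ 2) + ‖y‖ ^ 4 / (2 * c ^ 2) := by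
  set r := √(‖x‖ ^ 2 + c ^ 2) with hr
  set s := √(‖x + y‖ ^ 2 + c ^ 2) with hs
  have hr2 : r ^ 2 = ‖x‖ ^ 2 + c ^ 2 := Real.sq_sqrt (by positivity)
  have hs2 : s ^ 2 = ‖x + y‖ ^ 2 + c ^ 2 := Real.sq_sqrt (by positivity)
  have hrc : c ≤ r := Real.le_sqrt_of_sq_le (by nlinarith [sq_nonneg ‖x‖])
  have hsc : c ≤ s := Real.le_sqrt_of_sq_le (by nlinarith [sq_nonneg ‖x + y‖])
  have hr0 : 0 < r := hc.trans_le hrc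
  have hs0 : 0 < s := hc.trans_le hsc
  have hprod : (s - r) * (s + r) = 2 * inner ℝ x y + ‖y‖ ^ 2 := by
    have := norm_add_sq_real x y
    nlinarith
  have hsq : (s - r) ^ 2 = (2 * inner ℝ x y + ‖y‖ ^ 2) ^ 2 / (s + r) ^ 2 := by
    rw [← hprod]
    field_simp
  rw [hsq, ← hr2]
  calc _ ≤ (8 * (inner ℝ x y) ^ 2 + 2 * ‖y‖ ^ 4) / (s + r) ^ 2 := by
        gcongr
        nlinarith [sq_nonneg (2 * inner ℝ x y - ‖y‖ ^ 2)]
    _ = 8 * (inner ℝ x y) ^ 2 / (s + r) ^ 2 + 2 * ‖y‖ ^ 4 / (s + r) ^ 2 := add_div _ _ _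
    _ ≤ 8 * (inner ℝ x y) ^ 2 / r ^ 2 + 2 * ‖y‖ ^ 4 / (c + c) ^ 2 := by
        gcongr
        linarith
    _ = _ := by
        congr 1
        field_simp
        ring

lemma sq_sqrt_norm_bernSum_update_sub_le {n : ℕ} (Y : Fin n → E) {c : ℝ} (hc : 0 < c)
    (ω : Fin n → Bool) (k : Fin n) :
    (√(‖bernSum Y (Function.update ω k true)‖ ^ 2 + c ^ 2)
      - √(‖bernSum Y (Function.update ω k false)‖ ^ 2 + c ^ 2)) ^ 2 ≤
      8 * (inner ℝ (bernSum Y ω) (Y k)) ^ 2 / (‖bernSum Y ω‖ ^ 2 + c ^ 2)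
        + ‖Y k‖ ^ 4 / (2 * c ^ 2) := by
  have hu := bernSum_update Y ω k
  rcases hω : ω k with _ | _
  · have e : Function.update ω k false = ω := by rw [← hω, Function.update_eq_self]
    rw [hu, e]
    exact sq_sqrt_norm_add_sub_le hc _ _
  · have e : Function.update ω k true = ω := by rw [← hω, Function.update_eq_self]
    rw [e] at hu
    have hu' : bernSum Y (Function.update ω k false) = bernSum Y ω + -Y k := by
      rw [hu]; abel
    rw [e, hu', sub_sq_comm]
    have := sq_sqrt_norm_add_sub_le hc (bernSum Y ω) (-Y k)
    simpa using this

/-- Concentration of the norm of a centered sum of independent vectors around the root mean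
square, with the weak variance `s²`, for deviations `a * s` with `a * B ≤ s`. -/
theorem bernE_norm_bernSum_tail {n : ℕ} {p M B s a : ℝ} (h0 : 0 ≤ p) (h1 : p ≤ 1)
    (Y : Fin n → E) (hY : ∑ k, Y k = 0) (hM : 0 < M) (hs : 0 < s) (ha : 0 < a)
    (hYB : ∀ k, ‖Y k‖ ≤ B) (hYM : ∑ k, p * ‖Y k‖ ^ 2 ≤ M ^ 2)
    (hYs : ∀ x : E, ∑ k, p * (inner ℝ x (Y k)) ^ 2 ≤ s ^ 2 * ‖x‖ ^ 2)
    (hBs : B ≤ s) (haB : a * B ≤ s) :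
    bernE p (fun ω => if M + a * s ≤ ‖bernSum Y ω‖ then 1 else 0) ≤
      Real.exp (-(1 / 1000 * a ^ 2)) := by
  set c : ℝ := 4 / 3 * M with hc
  have hc0 : 0 < c := by positivity
  set f : (Fin n → Bool) → ℝ := fun ω => √(‖bernSum Y ω‖ ^ 2 + c ^ 2) with hf
  have hf2 : ∀ ω, f ω ^ 2 = ‖bernSum Y ω‖ ^ 2 + c ^ 2 := fun ω => Real.sq_sqrt (by positivity)
  have hsec : bernE p (fun ω => ‖bernSum Y ω‖ ^ 2) ≤ M ^ 2 := by
    rw [bernE_norm_sq_bernSum, hY]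
    rw [← Finset.mul_sum] at hYM
    have : 0 ≤ ∑ k, ‖Y k‖ ^ 2 := Finset.sum_nonneg fun _ _ => sq_nonneg _
    simp only [norm_zero]
    nlinarith [mul_nonneg (mul_nonneg h0 h0) this]
  have hmean : bernE p f ≤ 5 / 3 * M := by
    have hle := bernE_mono h0 h1 (f := fun ω => (10 / 3 * M) * f ω)
      (g := fun ω => ‖bernSum Y ω‖ ^ 2 + (c ^ 2 + (5 / 3 * M) ^ 2)) fun ω => by
        nlinarith [hf2 ω, sq_nonneg (f ω - 5 / 3 * M)]
    rw [bernE_const_mul, bernE_add, bernE_const] at hle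
    by_contra! hcon
    have := mul_lt_mul_of_pos_left hcon (by positivity : (0 : ℝ) < 10 / 3 * M)
    nlinarith
  have hinc : ∀ ω k,
      |f (Function.update ω k true) - f (Function.update ω k false)| ≤ B := by
    intro ω k
    simp only [hf]
    rw [bernSum_update]
    exact (abs_sqrt_norm_add_sub_le c _ _).trans (hYB k)
  have hD : ∀ ω, ∑ k, p * (f (Function.update ω k true) - f (Function.update ω k false)) ^ 2 ≤
      9 * s ^ 2 := by
    intro ω
    set x := bernSum Y ω
    have hk : ∀ k, p * (f (Function.update ω k true) - f (Function.update ω k false)) ^ 2 ≤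
        8 / (‖x‖ ^ 2 + c ^ 2) * (p * (inner ℝ x (Y k)) ^ 2)
          + s ^ 2 / (2 * c ^ 2) * (p * ‖Y k‖ ^ 2) := by
      intro k
      have hb := mul_le_mul_of_nonneg_left (sq_sqrt_norm_bernSum_update_sub_le Y hc0 ω k) h0
      have h4 : ‖Y k‖ ^ 4 ≤ s ^ 2 * ‖Y k‖ ^ 2 := by
        have : ‖Y k‖ ^ 2 ≤ s ^ 2 :=
          pow_le_pow_left₀ (norm_nonneg _) ((hYB k).trans hBs) 2
        nlinarith [sq_nonneg ‖Y k‖]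
      have h5 : p * (‖Y k‖ ^ 4 / (2 * c ^ 2)) ≤ p * (s ^ 2 * ‖Y k‖ ^ 2 / (2 * c ^ 2)) := by
        gcongr
      refine hb.trans ?_
      rw [mul_add]
      refine (add_le_add_right h5 _).trans (le_of_eq ?_)
      simp only [x]
      ring
    refine (Finset.sum_le_sum fun k _ => hk k).trans ?_
    rw [Finset.sum_add_distrib]
    have e1 : 8 / (‖x‖ ^ 2 + c ^ 2) * ∑ k, p * (inner ℝ x (Y k)) ^ 2 ≤ 8 * s ^ 2 := by
      rw [div_mul_eq_mul_div, div_le_iff₀ (by positivity)]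
      nlinarith [hYs x, mul_nonneg (sq_nonneg s) (sq_nonneg c)]
    have e2 : s ^ 2 / (2 * c ^ 2) * ∑ k, p * ‖Y k‖ ^ 2 ≤ s ^ 2 := by
      rw [div_mul_eq_mul_div, div_le_iff₀ (by positivity)]
      refine mul_le_mul_of_nonneg_left (hYM.trans ?_) (sq_nonneg s)
      rw [hc]
      nlinarith [sq_nonneg M]
    rw [Finset.mul_sum] at e1 e2
    linarith
  set l : ℝ := a / (100 * s) with hl
  have hl0 : 0 < l := by positivity
  have hlB : l * B ≤ 1 := by
    rw [hl, div_mul_eq_mul_div, div_le_one (by positivity)]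
    linarith
  have hlog := log_bernE_exp_le h0 h1 hinc hD hl0 hlB
  have hHpos : 0 < bernE p fun ω => Real.exp (l * f ω) :=
    bernE_pos h0 h1 fun _ => Real.exp_pos _
  have hcher : bernE p (fun ω => if M + a * s ≤ ‖bernSum Y ω‖ then 1 else 0) ≤
      Real.exp (-(l * (5 / 3 * M + 3 / 5 * (a * s)))) *
        bernE p fun ω => Real.exp (l * f ω) := by
    rw [← bernE_const_mul]
    refine bernE_mono h0 h1 fun ω => ?_
    rw [← Real.exp_add]
    split_ifs with hω
    · have hfω : 5 / 3 * M + 3 / 5 * (a * s) ≤ f ω := by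
        refine Real.le_sqrt_of_sq_le ?_
        have : (M + a * s) ^ 2 ≤ ‖bernSum Y ω‖ ^ 2 := by gcongr
        rw [hc]
        nlinarith [sq_nonneg (a * s)]
      refine Real.one_le_exp ?_
      have := mul_le_mul_of_nonneg_left hfω hl0.le
      linarith
    · positivity
  refine hcher.trans ?_
  rw [← Real.exp_log hHpos, ← Real.exp_add]
  refine Real.exp_le_exp.2 ?_
  have hm := mul_le_mul_of_nonneg_left hmean hl0.le
  have hls : l * (3 / 5 * (a * s)) = 3 / 500 * a ^ 2 := by
    rw [hl]; field_simp; ring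
  have hls2 : Real.exp 1 * (9 * s ^ 2) * l ^ 2 = Real.exp 1 * (9 / 10000 * a ^ 2) := by
    rw [hl]; field_simp; ring
  have he := Real.exp_one_lt_d9
  rw [hls2] at hlog
  nlinarith [mul_le_mul_of_nonneg_right he.le (by positivity : (0 : ℝ) ≤ 9 / 10000 * a ^ 2)]

/-- Second-moment bound, for deviations `t ≤ M`. -/
theorem bernE_norm_bernSum_tail_of_le {n : ℕ} {p M t : ℝ} (h0 : 0 ≤ p) (h1 : p ≤ 1)
    (Y : Fin n → E) (hY : ∑ k, Y k = 0) (hM : 0 < M) (ht : 0 ≤ t) (htM : t ≤ M)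
    (hYM : ∑ k, p * ‖Y k‖ ^ 2 ≤ M ^ 2) :
    bernE p (fun ω => if M + t ≤ ‖bernSum Y ω‖ then 1 else 0) ≤ Real.exp (-(t / M)) := by
  have hsec : bernE p (fun ω => ‖bernSum Y ω‖ ^ 2) ≤ M ^ 2 := by
    rw [bernE_norm_sq_bernSum, hY]
    rw [← Finset.mul_sum] at hYM
    have : 0 ≤ ∑ k, ‖Y k‖ ^ 2 := Finset.sum_nonneg fun _ _ => sq_nonneg _
    simp only [norm_zero]
    nlinarith [mul_nonneg (mul_nonneg h0 h0) this]
  have hpos : 0 < M + t := by positivity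
  have hle : bernE p (fun ω => if M + t ≤ ‖bernSum Y ω‖ then 1 else 0) ≤
      1 / (M + t) ^ 2 * bernE p (fun ω => ‖bernSum Y ω‖ ^ 2) := by
    rw [← bernE_const_mul]
    refine bernE_mono h0 h1 fun ω => ?_
    split_ifs with hω
    · rw [one_div_mul_eq_div, one_le_div (by positivity)]
      gcongr
    · positivity
  set x := t / M with hx
  have htx : t = x * M := by rw [hx]; field_simp
  have hx0 : 0 ≤ x := by positivity
  have hx1 : x ≤ 1 := (div_le_one hM).2 htM
  have h2 : Real.exp x ≤ (1 + x) ^ 2 := by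
    have := Real.exp_bound' hx0 hx1 (n := 2) (by norm_num)
    norm_num [Finset.sum_range_succ] at this
    nlinarith
  calc _ ≤ _ := hle
    _ ≤ 1 / (M + t) ^ 2 * M ^ 2 := by gcongr
    _ = ((1 + x) ^ 2)⁻¹ := by rw [htx]; field_simp
    _ ≤ (Real.exp x)⁻¹ := inv_anti₀ (Real.exp_pos x) h2
    _ = Real.exp (-x) := (Real.exp_neg x).symm

end Hilbert

lemma l2norm_inv_mulVec_le {ι : Type*} [Fintype ι] [DecidableEq ι] {A : Matrix ι ι ℝ} {c : ℝ}
    (hc : 0 < c) (hA : ∀ f : ι → ℝ, c * ∑ t, f t ^ 2 ≤ f ⬝ᵥ A.mulVec f) (v : ι → ℝ) :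
    c * l2norm (A⁻¹.mulVec v) ≤ l2norm v := by
  have hinj : Function.Injective A.mulVec := by
    refine (injective_iff_map_eq_zero A.mulVecLin).2 fun f hf => ?_
    have h := hA f
    rw [show A.mulVec f = 0 from hf, dotProduct_zero] at h
    have h0 : ∑ t, f t ^ 2 = 0 :=
      le_antisymm (by_contra fun hcon => by nlinarith [mul_pos hc (not_le.1 hcon)])
        (Finset.sum_nonneg fun _ _ => sq_nonneg _)
    funext t
    exact pow_eq_zero_iff two_ne_zero |>.1
      ((Finset.sum_eq_zero_iff_of_nonneg fun _ _ => sq_nonneg _).1 h0 t (Finset.mem_univ t))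
  have hdet : IsUnit A.det := (Matrix.isUnit_iff_isUnit_det A).1
    (Matrix.mulVec_injective_iff_isUnit.1 hinj)
  set w := A⁻¹.mulVec v with hw
  have hAw : A.mulVec w = v := by
    rw [hw, Matrix.mulVec_mulVec, Matrix.mul_nonsing_inv A hdet, Matrix.one_mulVec]
  have h := hA w
  rw [hAw] at h
  have hcs : w ⬝ᵥ v ≤ l2norm w * l2norm v := Real.sum_mul_le_sqrt_mul_sqrt _ _ _
  have hsq : ∑ t, w t ^ 2 = l2norm w ^ 2 :=
    (Real.sq_sqrt (Finset.sum_nonneg fun _ _ => sq_nonneg _)).symm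
  rw [hsq] at h
  rcases (Real.sqrt_nonneg (∑ t, w t ^ 2)).eq_or_lt with h0 | h0
  · rw [show l2norm w = 0 from h0.symm, mul_zero]
    exact Real.sqrt_nonneg _
  · exact le_of_mul_le_mul_left (by linarith : l2norm w * (c * l2norm w) ≤ _) h0

section Coherence

variable {n : ℕ} {U : Matrix (Fin n) (Fin n) ℝ}

lemma abs_le_coh (U : Matrix (Fin n) (Fin n) ℝ) (k j : Fin n) : |U k j| ≤ coh U :=
  (le_ciSup (f := fun j => |U k j|) (Set.finite_range _).bddAbove j).trans
    (le_ciSup (f := fun k => ⨆ j, |U k j|) (Set.finite_range _).bddAbove k)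

lemma sq_le_coh_sq (U : Matrix (Fin n) (Fin n) ℝ) (k j : Fin n) : U k j ^ 2 ≤ coh U ^ 2 :=
  sq_le_sq.2 ((abs_le_coh U k j).trans (le_abs_self _))

lemma sum_col_mul_col (hU : Uᵀ * U = (n : ℝ) • (1 : Matrix (Fin n) (Fin n) ℝ)) (i j : Fin n) :
    ∑ k, U k i * U k j = if i = j then (n : ℝ) else 0 := by
  have := congrFun (congrFun hU i) j
  simpa [Matrix.mul_apply, Matrix.one_apply] using this

lemma coh_pos (hU : Uᵀ * U = (n : ℝ) • (1 : Matrix (Fin n) (Fin n) ℝ)) (i : Fin n) :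
    0 < coh U := by
  have hn : (0 : ℝ) < n := by exact_mod_cast i.pos
  have h := sum_col_mul_col hU i i
  rw [if_pos rfl] at h
  by_contra! hcon
  have h0 : ∀ k, U k i = 0 := fun k => abs_nonpos_iff.1 ((abs_le_coh U k i).trans hcon)
  simp only [h0, mul_zero, Finset.sum_const_zero] at h
  exact hn.ne h

lemma sum_sq_sum_mul (hU : Uᵀ * U = (n : ℝ) • (1 : Matrix (Fin n) (Fin n) ℝ))
    (T : Finset (Fin n)) (x : T → ℝ) :
    ∑ k, (∑ t : T, x t * U k t) ^ 2 = n * ∑ t, x t ^ 2 := by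
  simp only [sq (∑ t : T, _), Finset.sum_mul_sum]
  rw [Finset.sum_comm, Finset.mul_sum]
  refine Finset.sum_congr rfl fun t _ => ?_
  rw [Finset.sum_comm]
  have : ∀ t' : T, ∑ k, x t * U k t * (x t' * U k t') =
      if t = t' then n * (x t * x t') else 0 := by
    intro t'
    have h := sum_col_mul_col hU t t'
    have e : ∑ k, x t * U k t * (x t' * U k t') = x t * x t' * ∑ k, U k t * U k t' := by
      rw [Finset.mul_sum]
      exact Finset.sum_congr rfl fun _ _ => by ring
    rw [e, h]
    by_cases htt : t = t'
    · simp [htt]; ring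
    · rw [if_neg htt, if_neg fun hc => htt (Subtype.ext hc), mul_zero]
  simp only [this]
  simp [sq]

/-- The summands of `v^{t₀}`. -/
noncomputable def scaledRow (U : Matrix (Fin n) (Fin n) ℝ) (T : Finset (Fin n)) (t₀ k : Fin n) :
    EuclideanSpace ℝ T :=
  WithLp.toLp 2 fun t => U k t₀ * U k t

lemma l2norm_eq_norm_bernSum (T : Finset (Fin n)) (t₀ : Fin n) (ω : Fin n → Bool) :
    l2norm (fun t : T => ∑ k, (if ω k then (1 : ℝ) else 0) * U k t₀ * U k t) =
      ‖bernSum (scaledRow U T t₀) ω‖ := by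
  rw [EuclideanSpace.norm_eq, l2norm]
  simp only [bernSum, scaledRow, WithLp.ofLp_sum, Finset.sum_apply, WithLp.ofLp_smul,
    Pi.smul_apply, smul_eq_mul, Real.norm_eq_abs, sq_abs, mul_assoc]

lemma sum_scaledRow (hU : Uᵀ * U = (n : ℝ) • (1 : Matrix (Fin n) (Fin n) ℝ))
    {T : Finset (Fin n)} {t₀ : Fin n} (ht₀ : t₀ ∉ T) : ∑ k, scaledRow U T t₀ k = 0 := by
  ext t
  have h := sum_col_mul_col hU t₀ t
  rw [if_neg fun hc : t₀ = t.1 => ht₀ (hc ▸ t.2)] at h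
  simpa [scaledRow] using h

lemma norm_sq_scaledRow_le (T : Finset (Fin n)) (t₀ k : Fin n) :
    ‖scaledRow U T t₀ k‖ ^ 2 ≤ U k t₀ ^ 2 * (coh U ^ 2 * T.card) := by
  rw [EuclideanSpace.norm_sq_eq]
  calc _ = ∑ t : T, U k t₀ ^ 2 * U k t ^ 2 := by simp [scaledRow, mul_pow]
    _ ≤ ∑ _t : T, U k t₀ ^ 2 * coh U ^ 2 := Finset.sum_le_sum fun t _ =>
        mul_le_mul_of_nonneg_left (sq_le_coh_sq U k t) (sq_nonneg _)
    _ = _ := by simp; ring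

lemma sum_norm_sq_scaledRow_le (hU : Uᵀ * U = (n : ℝ) • (1 : Matrix (Fin n) (Fin n) ℝ))
    (T : Finset (Fin n)) (t₀ : Fin n) :
    ∑ k, ‖scaledRow U T t₀ k‖ ^ 2 ≤ n * (coh U ^ 2 * T.card) := by
  have h := sum_col_mul_col hU t₀ t₀
  rw [if_pos rfl] at h
  rw [← h, Finset.sum_mul]
  simp only [← sq]
  exact Finset.sum_le_sum fun k _ => norm_sq_scaledRow_le T t₀ k

lemma sum_inner_sq_scaledRow_le (hU : Uᵀ * U = (n : ℝ) • (1 : Matrix (Fin n) (Fin n) ℝ))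
    (T : Finset (Fin n)) (t₀ : Fin n) (x : EuclideanSpace ℝ T) :
    ∑ k, (inner ℝ x (scaledRow U T t₀ k)) ^ 2 ≤ coh U ^ 2 * (n * ‖x‖ ^ 2) := by
  have hx : ‖x‖ ^ 2 = ∑ t, x t ^ 2 := by simp [EuclideanSpace.norm_sq_eq]
  rw [hx, ← sum_sq_sum_mul hU, Finset.mul_sum]
  refine Finset.sum_le_sum fun k _ => ?_
  have : inner ℝ x (scaledRow U T t₀ k) = U k t₀ * ∑ t : T, x t * U k t := by
    simp only [scaledRow, PiLp.inner_apply, Finset.mul_sum]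
    exact Finset.sum_congr rfl fun t _ => by simp; ring
  rw [this, mul_pow]
  exact mul_le_mul_of_nonneg_right (sq_le_coh_sq U k t₀) (sq_nonneg _)

/-- Tail bound for `v^{t₀}`. -/
theorem bernE_scaledRow_tail (hU : Uᵀ * U = (n : ℝ) • (1 : Matrix (Fin n) (Fin n) ℝ))
    {T : Finset (Fin n)} {t₀ : Fin n} (ht₀ : t₀ ∉ T) {m : ℕ} (hm : 0 < m) (hmn : m ≤ n)
    {a : ℝ} (ha : 0 < a)
    (hacond : if 1 < coh U * T.card / √m then a ≤ ((m : ℝ) / coh U ^ 2) ^ ((1 : ℝ) / 4)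
      else a ≤ ((m : ℝ) / (coh U ^ 2 * T.card)) ^ ((1 : ℝ) / 2)) :
    bernE ((m : ℝ) / n) (fun ω =>
        if coh U * √(m * T.card) + a * √(coh U ^ 2 * m * max 1 (coh U * T.card / √m)) ≤
          ‖bernSum (scaledRow U T t₀) ω‖ then 1 else 0) ≤
      Real.exp (-(1 / 1000 * a ^ 2)) := by
  have hm0 : (0 : ℝ) < m := by exact_mod_cast hm
  have hn0 : (0 : ℝ) < n := by exact_mod_cast hm.trans_le hmn
  have hp0 : 0 ≤ (m : ℝ) / n := by positivity
  have hp1 : (m : ℝ) / n ≤ 1 := (div_le_one hn0).2 (by exact_mod_cast hmn)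
  have hμ : 0 < coh U := coh_pos hU t₀
  set s := √(coh U ^ 2 * m * max 1 (coh U * T.card / √m)) with hs
  have hs2 : s ^ 2 = coh U ^ 2 * m * max 1 (coh U * T.card / √m) := Real.sq_sqrt (by positivity)
  have hs0 : 0 < s := Real.sqrt_pos.2 (by positivity)
  rcases T.eq_empty_or_nonempty with rfl | hT
  · have : bernE ((m : ℝ) / n) (fun ω =>
        if coh U * √(m * (∅ : Finset (Fin n)).card) + a * s ≤
          ‖bernSum (scaledRow U ∅ t₀) ω‖ then 1 else 0) = 0 := by
      refine Eq.trans ?_ (bernE_const (n := n) ((m : ℝ) / n) 0)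
      congr 1
      funext ω
      rw [Subsingleton.elim (bernSum (scaledRow U ∅ t₀) ω) 0]
      have : 0 < a * s := by positivity
      simp [this]
    rw [this]
    positivity
  have hN1 : (1 : ℝ) ≤ T.card := by exact_mod_cast hT.card_pos
  set μ := coh U with hμdef
  set N : ℝ := (T.card : ℝ) with hN
  have hN0 : 0 < N := by linarith
  set q := √(m : ℝ) with hq
  have hq0 : 0 < q := Real.sqrt_pos.2 hm0
  have hq2 : q ^ 2 = m := Real.sq_sqrt hm0.le
  set τ := √N with hτ
  have hτ0 : 0 < τ := Real.sqrt_pos.2 hN0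
  have hτ2 : τ ^ 2 = N := Real.sq_sqrt hN0.le
  have hM : μ * √(m * N) = μ * (q * τ) := by rw [Real.sqrt_mul hm0.le]
  rw [hM]
  set M := μ * (q * τ) with hMdef
  have hM0 : 0 < M := by positivity
  set B := μ ^ 2 * τ with hB
  have hB0 : 0 < B := by positivity
  have hsum := sum_scaledRow hU ht₀
  have hYB : ∀ k, ‖scaledRow U T t₀ k‖ ≤ B := by
    intro k
    refine le_of_sq_le_sq ?_ hB0.le
    refine (norm_sq_scaledRow_le T t₀ k).trans ?_
    have := mul_le_mul_of_nonneg_right (sq_le_coh_sq U k t₀)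
      (by positivity : 0 ≤ coh U ^ 2 * (T.card : ℝ))
    refine this.trans (le_of_eq ?_)
    rw [hB, mul_pow, hτ2]
    ring
  have hYM : ∑ k, (m : ℝ) / n * ‖scaledRow U T t₀ k‖ ^ 2 ≤ M ^ 2 := by
    rw [← Finset.mul_sum]
    refine (mul_le_mul_of_nonneg_left (sum_norm_sq_scaledRow_le hU T t₀) hp0).trans
      (le_of_eq ?_)
    rw [← hμdef, ← hN, hMdef, mul_pow, mul_pow, hq2, hτ2]
    field_simp
  have hYs : ∀ x : EuclideanSpace ℝ T,
      ∑ k, (m : ℝ) / n * (inner ℝ x (scaledRow U T t₀ k)) ^ 2 ≤ s ^ 2 * ‖x‖ ^ 2 := by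
    intro x
    rw [← Finset.mul_sum]
    refine (mul_le_mul_of_nonneg_left (sum_inner_sq_scaledRow_le hU T t₀ x) hp0).trans ?_
    have e : (m : ℝ) / n * (μ ^ 2 * (n * ‖x‖ ^ 2)) = μ ^ 2 * m * 1 * ‖x‖ ^ 2 := by
      field_simp
    rw [← hμdef, e, hs2]
    gcongr
    exact le_max_left _ _
  by_cases hcase : 1 < μ * N / q
  · rw [if_pos hcase] at hacond
    rw [max_eq_right hcase.le] at hs2
    have hsBM : s ^ 2 = B * M := by
      rw [hs2, hB, hMdef, ← hq2, ← hτ2]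
      field_simp
    have ha4 : a ^ 4 ≤ m / μ ^ 2 := by
      have := pow_le_pow_left₀ ha.le hacond 4
      rwa [← Real.rpow_mul_natCast (by positivity),
        show (1 : ℝ) / 4 * ((4 : ℕ) : ℝ) = 1 by norm_num, Real.rpow_one] at this
    have ha2 : a ^ 2 * μ ≤ q := by
      refine le_of_sq_le_sq ?_ hq0.le
      rw [le_div_iff₀ (by positivity)] at ha4
      rw [hq2]
      linarith
    have haB : a * B ≤ s := by
      refine le_of_sq_le_sq ?_ hs0.le
      have e : (a * B) ^ 2 = (a ^ 2 * μ) * (μ ^ 3 * τ ^ 2) := by rw [hB]; ring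
      rw [hsBM, e, hB, hMdef]
      refine (mul_le_mul_of_nonneg_right ha2 (by positivity)).trans (le_of_eq (by ring))
    rcases le_or_gt B s with hBs | hBs
    · exact bernE_norm_bernSum_tail hp0 hp1 _ hsum hM0 hs0 ha hYB hYM hYs hBs haB
    · have htM : a * s ≤ M := by
        refine le_of_mul_le_mul_left ?_ hB0
        rw [← hsBM]
        linarith [mul_le_mul_of_nonneg_right haB hs0.le]
      refine (bernE_norm_bernSum_tail_of_le hp0 hp1 _ hsum hM0 (by positivity) htM hYM).trans
        (Real.exp_le_exp.2 ?_)
      have hMs : M ≤ s := by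
        refine le_of_mul_le_mul_left ?_ hB0
        rw [← hsBM, sq]
        exact mul_le_mul_of_nonneg_right hBs.le hs0.le
      have ha1 : a ≤ 1 :=
        le_of_mul_le_mul_right (by linarith) hB0
      rw [neg_le_neg_iff, le_div_iff₀ hM0]
      have : a * M ≤ s := (mul_le_of_le_one_left hM0.le ha1).trans hMs
      linarith [mul_le_mul_of_nonneg_left this ha.le, mul_pos (mul_pos ha ha) hM0]
  · rw [if_neg hcase] at hacond
    rw [max_eq_left (not_lt.1 hcase), mul_one] at hs2
    have hμN : μ * N ≤ q := by rwa [not_lt, div_le_one hq0] at hcase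
    have hBs : B ≤ s := by
      refine le_of_sq_le_sq ?_ hs0.le
      rw [hs2, hB, mul_pow, hτ2, ← hq2]
      have h1 : (μ * N) ^ 2 ≤ q ^ 2 := by gcongr
      have h2 : μ ^ 2 * N ≤ (μ * N) ^ 2 := by
        rw [mul_pow]
        gcongr
        exact le_self_pow₀ hN1 two_ne_zero
      calc (μ ^ 2) ^ 2 * N = μ ^ 2 * (μ ^ 2 * N) := by ring
        _ ≤ _ := by gcongr; linarith
    have haB : a * B ≤ s := by
      have ha2 : a ^ 2 ≤ m / (μ ^ 2 * N) := by
        have := pow_le_pow_left₀ ha.le hacond 2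
        rwa [← Real.rpow_mul_natCast (by positivity),
          show (1 : ℝ) / 2 * ((2 : ℕ) : ℝ) = 1 by norm_num, Real.rpow_one] at this
      rw [le_div_iff₀ (by positivity)] at ha2
      refine le_of_sq_le_sq ?_ hs0.le
      rw [hs2]
      calc (a * B) ^ 2 = μ ^ 2 * (a ^ 2 * (μ ^ 2 * N)) := by rw [hB, ← hτ2]; ring
        _ ≤ _ := by gcongr
    exact bernE_norm_bernSum_tail hp0 hp1 _ hsum hM0 hs0 ha hYB hYM hYs hBs haB

end Coherence

lemma bprob_eq_bernE (n m : ℕ) (P : (Fin n → Bool) → Prop) :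
    bprob n m P = bernE ((m : ℝ) / n) fun ω => if P ω then 1 else 0 :=
  Finset.sum_congr rfl fun ω _ => by
    rw [mul_ite, mul_one, mul_zero]
    rfl

/-- Lemma 3.5.  There is an absolute constant `γ > 0` such
that: with coherence `μ`, Bernoulli(m/n) sampling `Ω = {k : δ_k = 1}`, the Gram
matrix `U_{ΩT}ᵀU_{ΩT} = Σ_k δ_k u^k ⊗ u^k`, `v^{t₀} = Σ_k δ_k U_{k,t₀} u^k` and
`w^{t₀} = (U_{ΩT}ᵀU_{ΩT})⁻¹ v^{t₀}` for `t₀ ∉ T`, `σ̄² = μ²m·max(1, μ|T|/√m)`,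
and `a > 0` as in Lemma 3.4, one has
`P(λ_min < m/2 or sup_{t₀∉T} ‖w^{t₀}‖ ≥ 2μ√(|T|/m) + 2aσ̄/m)
  ≤ n·exp(-γa²) + P(λ_min < m/2)`
(`λ_min(M) < m/2` is expressed by its Rayleigh-quotient characterization). -/
theorem statement10 :
    ∃ γ : ℝ, 0 < γ ∧
      ∀ (n m : ℕ) (U : Matrix (Fin n) (Fin n) ℝ),
        Uᵀ * U = (n : ℝ) • (1 : Matrix (Fin n) (Fin n) ℝ) →
        ∀ T : Finset (Fin n),
          0 < m → m ≤ n →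
          ∀ a : ℝ, 0 < a →
            (if 1 < coh U * T.card / Real.sqrt m then
                a ≤ ((m : ℝ) / coh U ^ 2) ^ ((1 : ℝ) / 4)
              else a ≤ ((m : ℝ) / (coh U ^ 2 * T.card)) ^ ((1 : ℝ) / 2)) →
            bprob n m
                (fun ω =>
                  (∃ f : ↥T → ℝ,
                    f ⬝ᵥ (∑ k : Fin n,
                        (if ω k then (1 : ℝ) else 0) •
                          Matrix.vecMulVec (fun t : ↥T => U k t.1)
                            (fun t : ↥T => U k t.1)).mulVec f <
                      (m : ℝ) / 2 * ∑ t, f t ^ 2) ∨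
                  (∃ t₀ : Fin n, t₀ ∉ T ∧
                    2 * coh U * Real.sqrt ((T.card : ℝ) / m) +
                        2 * a * Real.sqrt (coh U ^ 2 * m *
                          max 1 (coh U * T.card / Real.sqrt m)) / m ≤
                      l2norm
                        ((∑ k : Fin n,
                            (if ω k then (1 : ℝ) else 0) •
                              Matrix.vecMulVec (fun t : ↥T => U k t.1)
                                (fun t : ↥T => U k t.1))⁻¹.mulVec
                          (fun t : ↥T =>
                            ∑ k : Fin n,
                              (if ω k then (1 : ℝ) else 0) * U k t₀ * U k t.1)))) ≤
              (n : ℝ) * Real.exp (-(γ * a ^ 2)) +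
                bprob n m
                  (fun ω =>
                    ∃ f : ↥T → ℝ,
                      f ⬝ᵥ (∑ k : Fin n,
                          (if ω k then (1 : ℝ) else 0) •
                            Matrix.vecMulVec (fun t : ↥T => U k t.1)
                              (fun t : ↥T => U k t.1)).mulVec f <
                        (m : ℝ) / 2 * ∑ t, f t ^ 2) := by
  refine ⟨1 / 1000, by norm_num, ?_⟩
  intro n m U hU T hm hmn a ha hacond
  have hm0 : (0 : ℝ) < m := by exact_mod_cast hm
  have hn0 : (0 : ℝ) < n := by exact_mod_cast hm.trans_le hmn
  have hp0 : 0 ≤ (m : ℝ) / n := by positivity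
  have hp1 : (m : ℝ) / n ≤ 1 := (div_le_one hn0).2 (by exact_mod_cast hmn)
  set G : (Fin n → Bool) → Matrix T T ℝ := fun ω => ∑ k : Fin n,
    (if ω k then (1 : ℝ) else 0) •
      Matrix.vecMulVec (fun t : ↥T => U k t.1) (fun t : ↥T => U k t.1) with hG
  set b := coh U * √(m * T.card) + a * √(coh U ^ 2 * m * max 1 (coh U * T.card / √m)) with hb
  have htail : ∑ t₀ ∈ Tᶜ, bernE ((m : ℝ) / n) (fun ω =>
      if b ≤ ‖bernSum (scaledRow U T t₀) ω‖ then 1 else 0) ≤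
      n * Real.exp (-(1 / 1000 * a ^ 2)) := by
    refine (Finset.sum_le_card_nsmul _ _ _ fun t₀ ht₀ =>
      bernE_scaledRow_tail hU (Finset.mem_compl.1 ht₀) hm hmn ha hacond).trans ?_
    rw [nsmul_eq_mul]
    gcongr
    exact (Finset.card_le_univ _).trans_eq (Fintype.card_fin n)
  have hw : ∀ ω, (¬ ∃ f : T → ℝ, f ⬝ᵥ (G ω).mulVec f < (m : ℝ) / 2 * ∑ t, f t ^ 2) →
      ∀ t₀, 2 * coh U * √((T.card : ℝ) / m) +
          2 * a * √(coh U ^ 2 * m * max 1 (coh U * T.card / √m)) / m ≤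
        l2norm ((G ω)⁻¹.mulVec fun t : T =>
          ∑ k : Fin n, (if ω k then (1 : ℝ) else 0) * U k t₀ * U k t) →
      b ≤ ‖bernSum (scaledRow U T t₀) ω‖ := by
    intro ω hω t₀ h
    push Not at hω
    have hv := l2norm_inv_mulVec_le (by positivity) hω
      (fun t : T => ∑ k : Fin n, (if ω k then (1 : ℝ) else 0) * U k t₀ * U k t)
    rw [l2norm_eq_norm_bernSum] at hv
    refine le_trans (le_of_eq ?_) ((mul_le_mul_of_nonneg_left h (by positivity)).trans hv)
    have e : √((m : ℝ) * T.card) = m * √((T.card : ℝ) / m) := by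
      rw [show (m : ℝ) * T.card = m ^ 2 * ((T.card : ℝ) / m) by field_simp,
        Real.sqrt_mul (by positivity), Real.sqrt_sq hm0.le]
    rw [hb, e]
    field_simp
  refine le_trans ?_ (add_le_add_left htail _)
  rw [bprob_eq_bernE, bprob_eq_bernE, ← bernE_sum, ← bernE_add]
  refine bernE_mono hp0 hp1 fun ω => ?_
  have hnn : 0 ≤ ∑ t₀ ∈ Tᶜ, (if b ≤ ‖bernSum (scaledRow U T t₀) ω‖ then (1 : ℝ) else 0) :=
    Finset.sum_nonneg fun _ _ => by split_ifs <;> norm_num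
  by_cases hA : ∃ f : T → ℝ, f ⬝ᵥ (G ω).mulVec f < (m : ℝ) / 2 * ∑ t, f t ^ 2
  · rw [if_pos (Or.inl hA), if_pos hA]
    linarith
  · rw [if_neg hA, add_zero]
    split_ifs with h
    · obtain ⟨t₀, ht₀, h⟩ := h.resolve_left hA
      have h1 : (1 : ℝ) = if b ≤ ‖bernSum (scaledRow U T t₀) ω‖ then (1 : ℝ) else 0 :=
        (if_pos (hw ω hA t₀ h)).symm
      exact h1.trans_le <| Finset.single_le_sum
        (f := fun t₀ => if b ≤ ‖bernSum (scaledRow U T t₀) ω‖ then (1 : ℝ) else 0)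
        (fun _ _ => by split_ifs <;> norm_num) (Finset.mem_compl.2 ht₀)
    · exact hnn
end
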